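/- arXiv:2604.13700 — 2 statements merged into one kernel-verified Lean document; each statement's English description precedes it below -/
import Mathlib

section
/- Let D be a digraph. For every vertex v ∈ V(D) there exist a set S ⊆ V(D) with |S| ≤ c(D) and a partition (A,B) of V(D)∖S such that N⁺_D(v) ⊆ A ∪ S, N⁻_D(v) ⊆ B ∪ S, and no arc of D starts in A and ends in B. -/
/-- A digraph: a finite vertex set together with a set of arcs (no loops). -/
structure FinDigraph (V : Type) [DecidableEq V] where
  verts : Finset V
  arcs : Finset (V × V)
  mem_of_arc : ∀ a ∈ arcs, a.1 ∈ verts ∧ a.2 ∈ verts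
  ne_of_arc : ∀ a ∈ arcs, a.1 ≠ a.2

namespace FinDigraph

variable {V : Type} [DecidableEq V]

/-- A directed cycle, represented as the list of its (distinct) vertices:
at least two vertices, consecutive vertices form arcs, and there is an arc
from the last vertex back to the first. -/
def IsCycle (D : FinDigraph V) (C : List V) : Prop :=
  C.Nodup ∧ 2 ≤ C.length ∧ C.Chain' (fun a b => (a, b) ∈ D.arcs) ∧
    ∀ h : C ≠ [], (C.getLast h, C.head h) ∈ D.arcs

/-- `D` contains a collection of `k` openly disjoint directed cycles through a vertex. -/
def HasOpenCycles (D : FinDigraph V) (k : ℕ) : Prop :=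
  ∃ (v : V) (C : Fin k → List V), v ∈ D.verts ∧
    (∀ i, D.IsCycle (C i) ∧ v ∈ C i) ∧
    ∀ i j, i ≠ j → Disjoint ((C i).toFinset \ {v}) ((C j).toFinset \ {v})

/-- `c(D)`: the largest `k` such that `D` contains `k` openly disjoint cycles through
a vertex. -/
noncomputable def cNum (D : FinDigraph V) : ℕ := sSup {k | D.HasOpenCycles k}

/-- The out-degree of a vertex. -/
def outDeg (D : FinDigraph V) (v : V) : ℕ := (D.arcs.filter fun a => a.1 = v).card

/-- The in-degree of a vertex. -/
def inDeg (D : FinDigraph V) (v : V) : ℕ := (D.arcs.filter fun a => a.2 = v).card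

/-- A digraph is `r`-regular if it is nonempty and every vertex has out- and in-degree
exactly `r`. -/
def IsRegular (D : FinDigraph V) (r : ℕ) : Prop :=
  D.verts.Nonempty ∧ ∀ v ∈ D.verts, D.outDeg v = r ∧ D.inDeg v = r

end FinDigraph

namespace FinDigraph

variable {V : Type} [DecidableEq V]

/-- The out-neighborhood of a vertex. -/
def outNbhd (D : FinDigraph V) (v : V) : Finset V :=
  D.verts.filter fun u => (v, u) ∈ D.arcs

/-- The in-neighborhood of a vertex. -/
def inNbhd (D : FinDigraph V) (v : V) : Finset V :=
  D.verts.filter fun u => (u, v) ∈ D.arcs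

end FinDigraph

/-- There is a walk from the first to the second vertex along the relation `r`, all of whose
vertices lie in `X`. -/
inductive WalkIn {V : Type} (r : V → V → Prop) (X : Set V) : V → V → Prop
  | nil {a : V} : a ∈ X → WalkIn r X a a
  | cons {a b c : V} : a ∈ X → r a b → WalkIn r X b c → WalkIn r X a c

namespace WalkIn

variable {V : Type} {r s : V → V → Prop} {X Y : Set V} {a b c : V}

theorem left_mem (h : WalkIn r X a b) : a ∈ X := by
  cases h <;> assumption

theorem right_mem (h : WalkIn r X a b) : b ∈ X := by
  induction h <;> assumption

theorem trans (h : WalkIn r X a b) (h' : WalkIn r X b c) : WalkIn r X a c := by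
  induction h with
  | nil => exact h'
  | cons ha hr _ ih => exact cons ha hr (ih h')

theorem snoc (h : WalkIn r X a b) (hr : r b c) (hc : c ∈ X) : WalkIn r X a c :=
  h.trans (cons h.right_mem hr (nil hc))

theorem mono (h : WalkIn r X a b) (hXY : X ⊆ Y) (hrs : ∀ u ∈ X, ∀ w ∈ X, r u w → s u w) :
    WalkIn s Y a b := by
  induction h with
  | nil ha => exact nil (hXY ha)
  | cons ha hr h ih => exact cons (hXY ha) (hrs _ ha _ h.left_mem hr) ih

theorem reverse (h : WalkIn r X a b) : WalkIn (flip r) X b a := by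
  induction h with
  | nil ha => exact nil ha
  | cons ha hr _ ih => exact ih.snoc hr ha

theorem inter_of_closed (h : WalkIn r X a b) (ha : a ∈ Y)
    (hY : ∀ u w, u ∈ X → u ∈ Y → r u w → w ∈ X → w ∈ Y) : WalkIn r (X ∩ Y) a b := by
  induction h with
  | nil h => exact nil ⟨h, ha⟩
  | cons h hr hw ih => exact cons ⟨h, ha⟩ hr (ih (hY _ _ h ha hr hw.left_mem))

theorem inter_reachable (h : WalkIn r X a b) : WalkIn r (X ∩ {z | WalkIn r X a z}) a b :=
  h.inter_of_closed (nil h.left_mem) fun _ _ _ hu hr hw => snoc hu hr hw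

/-- A walk either avoids `P` or can be cut at its first vertex in `P`. -/
theorem avoid_or_first (h : WalkIn r X a b) (P : Set V) :
    WalkIn r (X \ P) a b ∨
      ∃ p ∈ P, p ∈ X ∧ (a = p ∨ ∃ c, WalkIn r (X \ P) a c ∧ r c p) := by
  induction h with
  | @nil a ha =>
    by_cases hP : a ∈ P
    · exact .inr ⟨a, hP, ha, .inl rfl⟩
    · exact .inl (nil ⟨ha, hP⟩)
  | @cons a b c ha hr _ ih =>
    by_cases hP : a ∈ P
    · exact .inr ⟨a, hP, ha, .inl rfl⟩
    · rcases ih with h | ⟨p, hp, hpX, rfl | ⟨c, hc, hcp⟩⟩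
      · exact .inl (cons ⟨ha, hP⟩ hr h)
      · exact .inr ⟨b, hp, hpX, .inr ⟨a, nil ⟨ha, hP⟩, hr⟩⟩
      · exact .inr ⟨p, hp, hpX, .inr ⟨c, cons ⟨ha, hP⟩ hr hc, hcp⟩⟩

theorem exists_path (h : WalkIn r X a b) :
    ∃ l : List V, (a :: l).Nodup ∧ (a :: l).IsChain r ∧
      (a :: l).getLast (List.cons_ne_nil a l) = b ∧ ∀ z ∈ a :: l, z ∈ X := by
  induction h with
  | nil ha => exact ⟨[], by simp, by simp, rfl, by simpa using ha⟩
  | @cons a b c ha hr _ ih =>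
    obtain ⟨l, hnd, hch, hlast, hX⟩ := ih
    by_cases hmem : a ∈ b :: l
    · obtain ⟨l₁, l₂, heq⟩ := List.append_of_mem hmem
      refine ⟨l₂, ?_, ?_, ?_, ?_⟩
      · rw [heq] at hnd
        exact hnd.of_append_right
      · rw [heq] at hch
        exact hch.right_of_append
      · simp only [heq] at hlast
        rwa [List.getLast_append_of_ne_nil _ (List.cons_ne_nil a l₂)] at hlast
      · intro z hz
        exact hX z (heq ▸ List.mem_append_right l₁ hz)
    · refine ⟨b :: l, List.nodup_cons.2 ⟨hmem, hnd⟩, List.isChain_cons_cons.2 ⟨hr, hch⟩, ?_, ?_⟩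
      · rwa [List.getLast_cons (List.cons_ne_nil b l)]
      · intro z hz
        rcases List.mem_cons.1 hz with rfl | hz
        · exact ha
        · exact hX z hz

end WalkIn

section Menger

variable {V : Type}

/-- Every walk from `A` to `B` meets `S`. -/
def Separates (r : V → V → Prop) (A B S : Finset V) : Prop :=
  ∀ a ∈ A, ∀ b ∈ B, ¬ WalkIn r (↑S)ᶜ a b

/-- There are `k` pairwise disjoint sets, each of which carries a walk from `A` to `B`. -/
def Linked (r : V → V → Prop) (A B : Finset V) (k : ℕ) : Prop :=
  ∃ (I : Finset V) (X : V → Set V), I.card = k ∧ (I : Set V).PairwiseDisjoint X ∧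
    ∀ i ∈ I, ∃ a ∈ A, ∃ b ∈ B, WalkIn r (X i) a b

theorem Separates.flip {r : V → V → Prop} {A B S : Finset V} (h : Separates r A B S) :
    Separates (flip r) B A S :=
  fun b hb a ha hw => h a ha b hb hw.reverse

theorem Linked.mono {r s : V → V → Prop} {A B : Finset V} {k : ℕ} (h : Linked r A B k)
    (hrs : ∀ u w, r u w → s u w) : Linked s A B k := by
  obtain ⟨I, X, hI, hX, hw⟩ := h
  refine ⟨I, X, hI, hX, fun i hi => ?_⟩
  obtain ⟨a, ha, b, hb, hab⟩ := hw i hi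
  exact ⟨a, ha, b, hb, hab.mono subset_rfl fun u _ w _ => hrs u w⟩

theorem Linked.flip {r : V → V → Prop} {A B : Finset V} {k : ℕ} (h : Linked r A B k) :
    Linked (flip r) B A k := by
  obtain ⟨I, X, hI, hX, hw⟩ := h
  refine ⟨I, X, hI, hX, fun i hi => ?_⟩
  obtain ⟨a, ha, b, hb, hab⟩ := hw i hi
  exact ⟨b, hb, a, ha, hab.reverse⟩

/-- If `insert x S` is linked from `A` to full capacity, then the linking can be indexed by
its end vertices and trimmed to `S` and the vertices reachable from `A` outside `S`. -/
theorem Linked.trim [DecidableEq V] {r : V → V → Prop} {A S : Finset V} {x : V}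
    (h : Linked r A (insert x S) (insert x S).card) :
    ∃ X : V → Set V, (↑(insert x S) : Set V).PairwiseDisjoint X ∧
      (∀ p ∈ insert x S, ∃ a ∈ A, WalkIn r (X p) a p) ∧
      ∀ p ∈ insert x S, X p ⊆ {z | ∃ a ∈ A, WalkIn r (↑S)ᶜ a z} ∪ ↑S := by
  obtain ⟨I, X, hI, hX, hw⟩ := h
  set R : Set V := {z | ∃ a ∈ A, WalkIn r (↑S)ᶜ a z}
  have key : ∀ i : V, ∃ p : V, i ∈ I →
      p ∈ insert x S ∧ ∃ a ∈ A, WalkIn r (X i ∩ (R ∪ ↑S)) a p := by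
    intro i
    by_cases hi : i ∈ I
    swap
    · exact ⟨i, fun h => absurd h hi⟩
    obtain ⟨a, ha, b, hb, hab⟩ := hw i hi
    have hRS : ∀ p, (p ∉ S → p ∈ R) → p ∈ R ∪ ↑S := by
      intro p h
      by_cases hpS : p ∈ S
      · exact .inr hpS
      · exact .inl (h hpS)
    have hS : X i \ ↑(insert x S) ⊆ ((↑S)ᶜ : Set V) :=
      fun z hz hzS => hz.2 (Finset.mem_coe.2 (Finset.mem_insert_of_mem hzS))
    rcases hab.avoid_or_first ↑(insert x S) with h | ⟨p, hp, hpX, rfl | ⟨c, hc, hcp⟩⟩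
    · exact absurd (Finset.mem_coe.2 hb) h.right_mem.2
    · exact ⟨a, fun _ => ⟨hp, a, ha, .nil ⟨hpX, hRS a fun h => ⟨a, ha, .nil h⟩⟩⟩⟩
    · refine ⟨p, fun _ => ⟨hp, a, ha, ?_⟩⟩
      refine WalkIn.snoc (b := c) ?_ hcp ⟨hpX, hRS p fun h => ?_⟩
      · refine hc.inter_reachable.mono (fun z hz => ⟨hz.1.1, .inl ⟨a, ha, ?_⟩⟩) fun _ _ _ _ h => h
        exact WalkIn.mono hz.2 hS fun _ _ _ _ h => h
      · exact ⟨a, ha, (hc.mono hS fun _ _ _ _ h => h).snoc hcp h⟩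
  choose f hf using key
  have hinj : Set.InjOn f I := by
    intro i hi j hj hij
    by_contra hne
    obtain ⟨_, _, _, h₁⟩ := hf i hi
    obtain ⟨_, _, _, h₂⟩ := hf j hj
    exact Set.disjoint_left.1 (hX hi hj hne) h₁.right_mem.1 (hij ▸ h₂.right_mem.1)
  have himg : I.image f = insert x S := by
    refine Finset.eq_of_subset_of_card_le (fun p hp => ?_) ?_
    · obtain ⟨i, hi, rfl⟩ := Finset.mem_image.1 hp
      exact (hf i hi).1
    · rw [Finset.card_image_of_injOn hinj, hI]
  have hsurj : ∀ p : V, ∃ i : V, p ∈ insert x S → i ∈ I ∧ f i = p := by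
    intro p
    by_cases hp : p ∈ insert x S
    · rw [← himg] at hp
      obtain ⟨i, hi⟩ := Finset.mem_image.1 hp
      exact ⟨i, fun _ => hi⟩
    · exact ⟨p, fun h => absurd h hp⟩
  choose g hg using hsurj
  refine ⟨fun p => X (g p) ∩ (R ∪ ↑S), ?_, ?_, fun p _ => Set.inter_subset_right⟩
  · intro p hp q hq hpq
    have hne : g p ≠ g q := fun h => hpq (by rw [← (hg p hp).2, ← (hg q hq).2, h])
    exact (hX (hg p hp).1 (hg q hq).1 hne).mono Set.inter_subset_left Set.inter_subset_left
  · intro p hp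
    obtain ⟨_, a, ha, h⟩ := hf _ (hg p hp).1
    rw [(hg p hp).2] at h
    exact ⟨a, ha, h⟩

/-- The relation `r` together with the arc from `x` to `y`. -/
def addArc (r : V → V → Prop) (x y : V) (u w : V) : Prop := r u w ∨ (u = x ∧ w = y)

theorem flip_addArc (r : V → V → Prop) (x y : V) :
    flip (addArc r x y) = addArc (flip r) y x := by
  ext u w
  simp only [flip, addArc, and_comm]

theorem Separates.insert_left [DecidableEq V] {r : V → V → Prop} {A B S : Finset V} {x : V}
    (h : Separates r A B S) (y : V) : Separates (addArc r x y) A B (insert x S) := by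
  intro a ha b hb hw
  refine h a ha b hb (hw.mono ?_ ?_)
  · exact Set.compl_subset_compl.2 (Finset.coe_subset.2 (Finset.subset_insert x S))
  · rintro u hu w _ (hr | ⟨rfl, -⟩)
    · exact hr
    · exact absurd (Finset.mem_coe.2 (Finset.mem_insert_self _ S)) hu

theorem Separates.of_separates_insert [DecidableEq V] {r : V → V → Prop} {A B S T : Finset V}
    {x y : V} (h : Separates r A B S) (hT : Separates r A (insert x S) T) :
    Separates (addArc r x y) A B T := by
  intro a ha b hb hw
  have hx : x ∈ (↑(insert x S) : Set V) := Finset.mem_coe.2 (Finset.mem_insert_self x S)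
  rcases hw.avoid_or_first ↑(insert x S) with h' | ⟨p, hp, hpX, rfl | ⟨c, hc, hcp⟩⟩
  · exact h.insert_left y a ha b hb (h'.mono (fun z hz => hz.2) fun _ _ _ _ h => h)
  · exact hT a ha a hp (.nil hpX)
  · refine hT a ha p hp (WalkIn.snoc (b := c) (hc.mono Set.sdiff_subset ?_) ?_ hpX)
    · rintro u hu w _ (hr | ⟨rfl, -⟩)
      · exact hr
      · exact absurd hx hu.2
    · rcases hcp with hr | ⟨rfl, -⟩
      · exact hr
      · exact absurd hx hc.right_mem.2

theorem Linked.glue [DecidableEq V] {r : V → V → Prop} {A B S : Finset V} {x y : V}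
    (hx : x ∉ S) (hy : y ∉ S) (hS : Separates r A B S)
    (hA : Linked r A (insert x S) (S.card + 1)) (hB : Linked r (insert y S) B (S.card + 1)) :
    Linked (addArc r x y) A B (S.card + 1) := by
  rw [← Finset.card_insert_of_notMem hx] at hA
  rw [← Finset.card_insert_of_notMem hy] at hB
  obtain ⟨X, hXd, hXw, hXR⟩ := hA.trim
  obtain ⟨Y, hYd, hYw, hYR⟩ := hB.flip.trim
  have hXY : ∀ p ∈ insert x S, ∀ q ∈ insert y S, ∀ z ∈ X p, z ∈ Y q → z ∈ S ∧ p = z ∧ q = z := by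
    intro p hp q hq z hzX hzY
    have hz : z ∈ S := by
      rcases hXR p hp hzX with ⟨a, ha, h₁⟩ | h
      · rcases hYR q hq hzY with ⟨b, hb, h₂⟩ | h
        · exact absurd (h₁.trans h₂.reverse) (hS a ha b hb)
        · exact h
      · exact h
    refine ⟨hz, ?_, ?_⟩
    · by_contra hne
      obtain ⟨_, _, h⟩ := hXw z (Finset.mem_insert_of_mem hz)
      exact Set.disjoint_left.1 (hXd hp (Finset.mem_insert_of_mem hz) hne) hzX h.right_mem
    · by_contra hne
      obtain ⟨_, _, h⟩ := hYw z (Finset.mem_insert_of_mem hz)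
      exact Set.disjoint_left.1 (hYd hq (Finset.mem_insert_of_mem hz) hne) hzY h.right_mem
  let φ : V → V := fun p => if p = x then y else p
  have hφ : ∀ p ∈ insert x S, φ p ∈ insert y S := by
    intro p hp
    by_cases h : p = x
    · simp [φ, h]
    · simpa [φ, h] using .inr ((Finset.mem_insert.1 hp).resolve_left h)
  have hφS : ∀ p, φ p ∈ S → φ p = p := by
    intro p hp
    by_cases h : p = x
    · simp [φ, h, hy] at hp
    · simp [φ, h]
  have hφinj : ∀ p ∈ insert x S, ∀ q ∈ insert x S, φ p = φ q → p = q := by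
    intro p hp q hq hpq
    simp only [φ] at hpq
    grind
  refine ⟨insert x S, fun p => X p ∪ Y (φ p), Finset.card_insert_of_notMem hx, ?_, ?_⟩
  · intro p hp q hq hpq
    have hcross : ∀ p ∈ insert x S, ∀ q ∈ insert x S, p ≠ q → ∀ z ∈ X p, z ∉ Y (φ q) := by
      intro p hp q hq hpq z hzX hzY
      obtain ⟨hz, rfl, h⟩ := hXY p hp _ (hφ q hq) z hzX hzY
      exact hpq (h.symm.trans (hφS q (h ▸ hz)))
    refine Set.disjoint_left.2 ?_
    rintro z (hz | hz) (hz' | hz')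
    · exact Set.disjoint_left.1 (hXd hp hq hpq) hz hz'
    · exact hcross p hp q hq hpq z hz hz'
    · exact hcross q hq p hp hpq.symm z hz' hz
    · exact Set.disjoint_left.1
        (hYd (hφ p hp) (hφ q hq) fun h => hpq (hφinj p hp q hq h)) hz hz'
  · intro p hp
    obtain ⟨a, ha, h₁⟩ := hXw p hp
    obtain ⟨b, hb, h₂⟩ := hYw _ (hφ p hp)
    have h₁' : WalkIn (addArc r x y) (X p ∪ Y (φ p)) a p :=
      h₁.mono Set.subset_union_left fun _ _ _ _ h => .inl h
    have h₂' : WalkIn (addArc r x y) (X p ∪ Y (φ p)) (φ p) b :=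
      h₂.reverse.mono Set.subset_union_right fun _ _ _ _ h => .inl h
    refine ⟨a, ha, b, hb, ?_⟩
    by_cases h : p = x
    · exact h₁'.trans (.cons h₁'.right_mem (.inr ⟨h, by simp [φ, h]⟩) h₂')
    · have hpp : φ p = p := by simp [φ, h]
      exact h₁'.trans (by simpa only [hpp] using h₂')

/-- **Menger's theorem** for finite digraphs, in the version for disjoint paths between two
sets of vertices. -/
theorem linked_of_forall_separates [DecidableEq V] (E : Finset (V × V)) :
    ∀ (A B : Finset V) (k : ℕ),
      (∀ S, Separates (fun u w => (u, w) ∈ E) A B S → k ≤ S.card) →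
      Linked (fun u w => (u, w) ∈ E) A B k := by
  induction E using Finset.induction_on with
  | empty =>
    intro A B k hk
    have hsep : Separates (fun u w => (u, w) ∈ (∅ : Finset (V × V))) A B (A ∩ B) := by
      intro a ha b hb hw
      cases hw with
      | nil h => exact h (Finset.mem_coe.2 (Finset.mem_inter.2 ⟨ha, hb⟩))
      | cons _ h _ => simp at h
    obtain ⟨I, hIs, hI⟩ := Finset.exists_subset_card_eq (hk _ hsep)
    refine ⟨I, fun i => {i}, hI, fun i _ j _ hij => by simpa using hij, fun i hi => ?_⟩
    have := Finset.mem_inter.1 (hIs hi)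
    exact ⟨i, this.1, i, this.2, .nil rfl⟩
  | insert e E _ ih =>
    intro A B k hk
    obtain ⟨x, y⟩ := e
    have hadd : (fun u w => (u, w) ∈ insert (x, y) E) =
        addArc (fun u w => (u, w) ∈ E) x y := by
      ext u w
      simp only [addArc, Finset.mem_insert, Prod.mk.injEq, or_comm]
    rw [hadd] at hk ⊢
    by_cases hall : ∀ S, Separates (fun u w => (u, w) ∈ E) A B S → k ≤ S.card
    · exact (ih A B k hall).mono fun u w h => .inl h
    push Not at hall
    obtain ⟨S, hS, hSk⟩ := hall
    have hP := hk _ (hS.insert_left y)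
    have hQ : k ≤ (insert y S).card := by
      have := hS.flip.insert_left (x := y) x
      rw [← flip_addArc] at this
      exact hk _ this.flip
    have hx : x ∉ S := fun h => by rw [Finset.insert_eq_of_mem h] at hP; omega
    have hy : y ∉ S := fun h => by rw [Finset.insert_eq_of_mem h] at hQ; omega
    rw [Finset.card_insert_of_notMem hx] at hP
    obtain rfl : k = S.card + 1 := by omega
    refine Linked.glue hx hy hS (ih _ _ _ fun T hT => hk T (hS.of_separates_insert hT))
      (ih _ _ _ fun T hT => hk T ?_)
    have := hS.flip.of_separates_insert (y := x) hT.flip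
    rw [← flip_addArc] at this
    exact this.flip

end Menger

namespace FinDigraph

variable {V : Type} [DecidableEq V]

theorem IsCycle.exists_mem_ne {D : FinDigraph V} {C : List V} (h : D.IsCycle C) (v : V) :
    ∃ u ∈ C, u ≠ v := by
  obtain ⟨hnd, hlen, -, -⟩ := h
  match C, hnd, hlen with
  | a :: b :: l, hnd, _ =>
    by_cases ha : a = v
    · refine ⟨b, by simp, fun hb => ?_⟩
      simp [ha, hb] at hnd
    · exact ⟨a, by simp, ha⟩

theorem IsCycle.subset_verts {D : FinDigraph V} {C : List V} (h : D.IsCycle C) :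
    ∀ u ∈ C, u ∈ D.verts := by
  obtain ⟨-, hlen, hch, hcl⟩ := h
  intro u hu
  match C, hlen, hch, hcl with
  | a :: l, _, hch, hcl =>
    have ha : a ∈ D.verts := (D.mem_of_arc _ (hcl (List.cons_ne_nil a l))).2
    exact hch.induction (fun z => z ∈ D.verts) _ (fun _ _ h _ => (D.mem_of_arc _ h).2)
      (fun _ => ha) u hu

theorem bddAbove_hasOpenCycles (D : FinDigraph V) : BddAbove {k | D.HasOpenCycles k} := by
  refine ⟨D.verts.card, ?_⟩
  rintro k ⟨v, C, -, hC, hd⟩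
  choose f hfC hfv using fun i => (hC i).1.exists_mem_ne v
  have hinj : Function.Injective f := by
    intro i j hij
    by_contra hne
    have hi : f i ∈ (C i).toFinset \ {v} := by simp [hfC, hfv]
    have hj : f i ∈ (C j).toFinset \ {v} := by simp [hij, hfC, hfv]
    exact Finset.disjoint_left.1 (hd i j hne) hi hj
  have := Finset.card_le_card_of_injOn (s := Finset.univ) f
    (fun i _ => (hC i).1.subset_verts _ (hfC i)) hinj.injOn
  simpa using this

/-- Disjoint walks from the out-neighborhood to the in-neighborhood of `v` that avoid `v` close
up to openly disjoint cycles through `v`. -/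
theorem hasOpenCycles_of_linked {D : FinDigraph V} {v : V} (hv : v ∈ D.verts) {k : ℕ}
    (h : Linked (fun a b => (a, b) ∈ D.arcs.filter fun e => e.2 ≠ v)
      (D.outNbhd v) (D.inNbhd v) k) : D.HasOpenCycles k := by
  obtain ⟨I, X, rfl, hX, hw⟩ := h
  have key : ∀ i : I, ∃ C : List V, (D.IsCycle C ∧ v ∈ C) ∧ ∀ z ∈ C, z ≠ v → z ∈ X i := by
    intro i
    obtain ⟨a, ha, b, hb, hab⟩ := hw i i.2
    have hva : (v, a) ∈ D.arcs := (Finset.mem_filter.1 ha).2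
    have hbv : (b, v) ∈ D.arcs := (Finset.mem_filter.1 hb).2
    have hab' := hab.inter_of_closed (Y := {v}ᶜ) (D.ne_of_arc _ hva).symm
      fun _ _ _ _ hr _ => (Finset.mem_filter.1 hr).2
    obtain ⟨l, hnd, hch, hlast, hl⟩ := hab'.exists_path
    refine ⟨v :: a :: l, ⟨⟨?_, by simp, ?_, fun _ => ?_⟩, by simp⟩, ?_⟩
    · exact List.nodup_cons.2 ⟨fun h => (hl v h).2 rfl, hnd⟩
    · exact List.isChain_cons_cons.2 ⟨hva, hch.imp fun _ _ h => (Finset.mem_filter.1 h).1⟩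
    · rw [List.getLast_cons (List.cons_ne_nil a l), hlast]
      exact hbv
    · intro z hz hzv
      exact (hl z ((List.mem_cons.1 hz).resolve_left hzv)).1
  choose C hC hCX using key
  let e := I.equivFin.symm
  refine ⟨v, fun i => C (e i), hv, fun i => hC (e i), fun i j hij => ?_⟩
  refine Finset.disjoint_left.2 fun z hz hz' => ?_
  simp only [Finset.mem_sdiff, List.mem_toFinset, Finset.mem_singleton] at hz hz'
  have hne : (e i : V) ≠ e j := fun h => hij (e.injective (Subtype.ext h))
  exact Set.disjoint_left.1 (hX (e i).2 (e j).2 hne) (hCX _ z hz.1 hz.2) (hCX _ z hz'.1 hz'.2)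

end FinDigraph

/-- For every vertex `v` of a digraph `D` there exist a set
`S ⊆ V(D)` with `|S| ≤ c(D)` and a partition `(A, B)` of `V(D) ∖ S` such that
`N⁺(v) ⊆ A ∪ S`, `N⁻(v) ⊆ B ∪ S`, and no arc of `D` starts in `A` and ends in `B`. -/
theorem exists_separator {V : Type} [DecidableEq V] (D : FinDigraph V) (v : V)
    (hv : v ∈ D.verts) :
    ∃ S A B : Finset V, S ⊆ D.verts ∧ S.card ≤ D.cNum ∧
      A ∪ B = D.verts \ S ∧ Disjoint A B ∧
      D.outNbhd v ⊆ A ∪ S ∧ D.inNbhd v ⊆ B ∪ S ∧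
      ∀ a ∈ A, ∀ b ∈ B, (a, b) ∉ D.arcs := by
  classical
  let r : V → V → Prop := fun a b => (a, b) ∈ D.arcs.filter fun e => e.2 ≠ v
  obtain ⟨T, hT, hTmin⟩ : ∃ T, Separates r (D.outNbhd v) (D.inNbhd v) T ∧
      ∀ T', Separates r (D.outNbhd v) (D.inNbhd v) T' → T.card ≤ T'.card := by
    have hne : {T | Separates r (D.outNbhd v) (D.inNbhd v) T}.Nonempty :=
      ⟨D.outNbhd v, fun a ha _ _ hw => hw.left_mem ha⟩
    exact ⟨_, Function.argminOn_mem Finset.card _ hne,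
      fun T' hT' => Function.argminOn_le Finset.card _ hT'⟩
  have hcard : T.card ≤ D.cNum :=
    le_csSup D.bddAbove_hasOpenCycles
      (FinDigraph.hasOpenCycles_of_linked hv (linked_of_forall_separates _ _ _ _ hTmin))
  have hS : Separates r (D.outNbhd v) (D.inNbhd v) (T ∩ D.verts) := by
    intro a ha b hb hw
    have hw' := hw.inter_of_closed (Y := D.verts) (Finset.mem_filter.1 ha).1
      fun _ _ _ _ h _ => (D.mem_of_arc _ (Finset.mem_filter.1 h).1).2
    refine hT a ha b hb (hw'.mono (fun z hz hzT => ?_) fun _ _ _ _ h => h)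
    exact hz.1 (Finset.mem_coe.2 (Finset.mem_inter.2 ⟨hzT, hz.2⟩))
  have hSD : T ∩ D.verts ⊆ D.verts := Finset.inter_subset_right
  have hSc : (T ∩ D.verts).card ≤ D.cNum :=
    (Finset.card_le_card Finset.inter_subset_left).trans hcard
  generalize T ∩ D.verts = S at hS hSD hSc
  let A := (D.verts \ S).filter fun z => z = v ∨ ∃ a ∈ D.outNbhd v, WalkIn r (↑S)ᶜ a z
  have hA : ∀ z, z ∈ A ↔ (z ∈ D.verts ∧ z ∉ S) ∧
      (z = v ∨ ∃ a ∈ D.outNbhd v, WalkIn r (↑S)ᶜ a z) := by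
    intro z
    simp [A]
  have hout : D.outNbhd v ⊆ A ∪ S := by
    intro u hu
    by_cases huS : u ∈ S
    · exact Finset.mem_union_right _ huS
    · exact Finset.mem_union_left _
        ((hA u).2 ⟨⟨(Finset.mem_filter.1 hu).1, huS⟩, .inr ⟨u, hu, .nil huS⟩⟩)
  refine ⟨S, A, (D.verts \ S) \ A, hSD, hSc,
    Finset.union_sdiff_of_subset (Finset.filter_subset _ _), Finset.disjoint_sdiff, hout, ?_, ?_⟩
  · intro u hu
    obtain ⟨huD, huv⟩ := Finset.mem_filter.1 hu
    by_cases huS : u ∈ S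
    · exact Finset.mem_union_right _ huS
    · refine Finset.mem_union_left _ (Finset.mem_sdiff.2 ⟨Finset.mem_sdiff.2 ⟨huD, huS⟩, ?_⟩)
      intro huA
      rcases ((hA u).1 huA).2 with rfl | ⟨a, ha, hw⟩
      · exact D.ne_of_arc _ huv rfl
      · exact hS a ha u hu hw
  · intro a ha b hb hab
    simp only [Finset.mem_sdiff] at hb
    obtain ⟨⟨hbD, hbS⟩, hbA⟩ := hb
    rcases ((hA a).1 ha).2 with rfl | ⟨c, hc, hw⟩
    · rcases Finset.mem_union.1 (hout (Finset.mem_filter.2 ⟨hbD, hab⟩)) with h | h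
      · exact hbA h
      · exact hbS h
    · refine hbA ((hA b).2 ⟨⟨hbD, hbS⟩, ?_⟩)
      by_cases hbv : b = v
      · exact .inl hbv
      · exact .inr ⟨c, hc, hw.snoc (Finset.mem_filter.2 ⟨hab, hbv⟩) hbS⟩
end

section
/- Every digraph D with at least one vertex satisfies a(D) < v(D)·(v(D) + c(D))/2. -/
namespace FinDigraph

variable {V : Type} [DecidableEq V]

theorem mem_verts_of_isChain (D : FinDigraph V) {a : V} {l : List V}
    (h : (a :: l).IsChain (fun a b => (a, b) ∈ D.arcs)) : ∀ b ∈ l, b ∈ D.verts := by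
  induction l generalizing a with
  | nil => simp
  | cons c l ih =>
    rw [List.isChain_cons_cons] at h
    intro b hb
    rcases List.mem_cons.1 hb with rfl | hb
    · exact (D.mem_of_arc _ h.1).2
    · exact ih h.2 b hb

theorem IsCycle.mem_verts {D : FinDigraph V} {C : List V} (hC : D.IsCycle C) :
    ∀ b ∈ C, b ∈ D.verts := by
  obtain ⟨-, -, hchain, hclose⟩ := hC
  cases C with
  | nil => simp
  | cons a l =>
    intro b hb
    rcases List.mem_cons.1 hb with rfl | hb
    · exact (D.mem_of_arc _ (hclose (by simp))).2
    · exact D.mem_verts_of_isChain hchain b hb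

theorem IsCycle.exists_mem_sdiff {D : FinDigraph V} {C : List V} (hC : D.IsCycle C) (v : V) :
    ∃ w, w ∈ C.toFinset \ {v} := by
  have hcard : 1 < C.toFinset.card := by
    rw [List.toFinset_card_of_nodup hC.1]
    exact hC.2.1
  obtain ⟨w, hw, hne⟩ := Finset.exists_mem_ne hcard v
  exact ⟨w, by simpa [hne] using hw⟩

theorem HasOpenCycles.le_card_verts {D : FinDigraph V} {k : ℕ} (h : D.HasOpenCycles k) :
    k ≤ D.verts.card := by
  obtain ⟨v, C, -, hC, hdisj⟩ := h
  choose w hw using fun i => (hC i).1.exists_mem_sdiff v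
  have hinj : Function.Injective w := by
    intro i j hij
    by_contra hne
    exact Finset.disjoint_left.1 (hdisj i j hne) (hw i) (hij ▸ hw j)
  have hle := Finset.card_le_card_of_injOn (s := Finset.univ) (t := D.verts) w
    (fun i _ => (hC i).1.mem_verts _ (List.mem_toFinset.1 (Finset.mem_sdiff.1 (hw i)).1))
    hinj.injOn
  simpa using hle

theorem HasOpenCycles.le_cNum {D : FinDigraph V} {k : ℕ} (h : D.HasOpenCycles k) :
    k ≤ D.cNum :=
  le_csSup ⟨D.verts.card, fun _ hk => HasOpenCycles.le_card_verts hk⟩ h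

/-- The out-neighbours of a vertex. -/
def outNbrs (D : FinDigraph V) (v : V) : Finset V := D.verts.filter fun u => (v, u) ∈ D.arcs

/-- The in-neighbours of a vertex. -/
def inNbrs (D : FinDigraph V) (v : V) : Finset V := D.verts.filter fun u => (u, v) ∈ D.arcs

theorem card_outNbrs (D : FinDigraph V) (v : V) : (D.outNbrs v).card = D.outDeg v := by
  refine Finset.card_bij (fun u _ => (v, u)) ?_ ?_ ?_
  · intro u hu
    simpa using (Finset.mem_filter.1 hu).2
  · simp
  · rintro ⟨x, u⟩ h
    obtain ⟨harc, rfl⟩ := Finset.mem_filter.1 h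
    exact ⟨u, Finset.mem_filter.2 ⟨(D.mem_of_arc _ harc).2, harc⟩, rfl⟩

theorem card_inNbrs (D : FinDigraph V) (v : V) : (D.inNbrs v).card = D.inDeg v := by
  refine Finset.card_bij (fun u _ => (u, v)) ?_ ?_ ?_
  · intro u hu
    simpa using (Finset.mem_filter.1 hu).2
  · simp
  · rintro ⟨u, x⟩ h
    obtain ⟨harc, rfl⟩ := Finset.mem_filter.1 h
    exact ⟨u, Finset.mem_filter.2 ⟨(D.mem_of_arc _ harc).1, harc⟩, rfl⟩

theorem sum_outDeg (D : FinDigraph V) : ∑ v ∈ D.verts, D.outDeg v = D.arcs.card :=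
  (Finset.card_eq_sum_card_fiberwise fun a ha => (D.mem_of_arc a ha).1).symm

theorem sum_inDeg (D : FinDigraph V) : ∑ v ∈ D.verts, D.inDeg v = D.arcs.card :=
  (Finset.card_eq_sum_card_fiberwise fun a ha => (D.mem_of_arc a ha).2).symm

theorem isCycle_pair {D : FinDigraph V} {v u : V} (hvu : (v, u) ∈ D.arcs)
    (huv : (u, v) ∈ D.arcs) : D.IsCycle [v, u] := by
  have hne : v ≠ u := D.ne_of_arc _ hvu
  exact ⟨by simpa using hne, by simp, List.isChain_pair.2 hvu, fun _ => by simpa using huv⟩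

/-- The 2-cycles through a vertex are openly disjoint. -/
theorem card_outNbrs_inter_inNbrs_le (D : FinDigraph V) {v : V} (hv : v ∈ D.verts) :
    (D.outNbrs v ∩ D.inNbrs v).card ≤ D.cNum := by
  refine HasOpenCycles.le_cNum ?_
  let e := (D.outNbrs v ∩ D.inNbrs v).equivFin.symm
  refine ⟨v, fun i => [v, (e i : V)], hv, fun i => ⟨?_, by simp⟩, fun i j hij => ?_⟩
  · obtain ⟨hout, hin⟩ := Finset.mem_inter.1 (e i).2
    exact isCycle_pair (Finset.mem_filter.1 hout).2 (Finset.mem_filter.1 hin).2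
  · have hne : (e i : V) ≠ e j := fun h => hij (e.injective (Subtype.ext h))
    rw [Finset.disjoint_left]
    intro x hxi hxj
    simp only [List.toFinset_cons, List.toFinset_nil, Finset.mem_sdiff, Finset.mem_insert,
      Finset.mem_singleton, insert_empty_eq] at hxi hxj
    exact hne ((hxi.1.resolve_left hxi.2).symm.trans (hxj.1.resolve_left hxj.2))

theorem outDeg_add_inDeg_lt (D : FinDigraph V) {v : V} (hv : v ∈ D.verts) :
    D.outDeg v + D.inDeg v < D.verts.card + D.cNum := by
  have hlt : (D.outNbrs v ∪ D.inNbrs v).card < D.verts.card := by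
    refine Finset.card_lt_card (Finset.ssubset_iff_of_subset ?_ |>.2 ⟨v, hv, ?_⟩)
    · exact Finset.union_subset (Finset.filter_subset _ _) (Finset.filter_subset _ _)
    · intro h
      have hloop : (v, v) ∈ D.arcs := by simpa [outNbrs, inNbrs, hv] using h
      exact D.ne_of_arc _ hloop rfl
  rw [← card_outNbrs, ← card_inNbrs, ← Finset.card_union_add_card_inter]
  exact add_lt_add_of_lt_of_le hlt (D.card_outNbrs_inter_inNbrs_le hv)

end FinDigraph

/-- Every digraph `D` with at least one vertex satisfies
`a(D) < v(D)·(v(D) + c(D))/2`. -/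
theorem arcs_lt_of_cNum {V : Type} [DecidableEq V] (D : FinDigraph V)
    (hne : D.verts.Nonempty) :
    (D.arcs.card : ℝ) < D.verts.card * (D.verts.card + D.cNum) / 2 := by
  have hsum : 2 * D.arcs.card < D.verts.card * (D.verts.card + D.cNum) := by
    calc 2 * D.arcs.card = ∑ v ∈ D.verts, (D.outDeg v + D.inDeg v) := by
          rw [Finset.sum_add_distrib, D.sum_outDeg, D.sum_inDeg, two_mul]
      _ < ∑ _v ∈ D.verts, (D.verts.card + D.cNum) :=
          Finset.sum_lt_sum_of_nonempty hne fun _ hv => D.outDeg_add_inDeg_lt hv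
      _ = D.verts.card * (D.verts.card + D.cNum) := by rw [Finset.sum_const, smul_eq_mul]
  have hcast : (2 * D.arcs.card : ℝ) < D.verts.card * (D.verts.card + D.cNum) := by
    exact_mod_cast hsum
  linarith
end
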